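/- As n → ∞, 𝔼(Π̂(n)) = n/M_n + n/M_n^2 + O(n/M_n^3). -/

import Mathlib

open MeasureTheory Filter Finset Asymptotics
open scoped Classical

/-- `y_m(α) = ∏_{j ∈ α, j < m} (1 - 1/j)` (empty product = 1). -/
noncomputable def hawkinsY (A : Set ℕ) (m : ℕ) : ℝ :=
  ∏ j ∈ Finset.range m, if j ∈ A then 1 - 1 / (j : ℝ) else 1

/-- The σ-algebra generated by the events `{j ∈ α}` for `2 ≤ j < m`. -/
def sieveSigma {Ω : Type*} (α : Ω → Set ℕ) (m : ℕ) : MeasurableSpace Ω :=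
  MeasurableSpace.generateFrom {s | ∃ j : ℕ, 2 ≤ j ∧ j < m ∧ s = {ω | j ∈ α ω}}

/-- Wunderlich's model of the Hawkins random sieve: a probability space `(Ω, μ)` with a
random subset `α` of `{2,3,4,…}` such that `μ(2 ∈ α) = 1` and, for every `m ≥ 2`, the
conditional probability of `{m ∈ α}` given the σ-algebra generated by the events
`{j ∈ α}`, `2 ≤ j < m`, equals `y_m(α)`. -/
structure IsHawkinsSieve {Ω : Type*} [MeasurableSpace Ω] (μ : Measure Ω)
    (α : Ω → Set ℕ) : Prop where
  isProb : IsProbabilityMeasure μ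
  meas : ∀ n : ℕ, MeasurableSet {ω | n ∈ α ω}
  mem_ge_two : ∀ ω, ∀ n ∈ α ω, 2 ≤ n
  two_mem : μ {ω | 2 ∈ α ω} = 1
  condExp_mem : ∀ m : ℕ, 2 ≤ m →
    μ[Set.indicator {ω | m ∈ α ω} (fun _ => (1 : ℝ)) | sieveSigma α m]
      =ᵐ[μ] fun ω => hawkinsY (α ω) m

/-- `M_k = 1 + ∑_{j=1}^{k-2} 1/j` (so `M_2 = 1`). -/
noncomputable def Mharm (k : ℕ) : ℝ := 1 + ∑ j ∈ Finset.Icc 1 (k - 2), 1 / (j : ℝ)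

/-- `Π̂(x; α) = Σ_{m ≤ x, m ∈ α, m+2 ∈ α} (y_m(α) - (1/(m+1))(1 - 1/m) y_m(α)^2)⁻¹`. -/
noncomputable def piHat (A : Set ℕ) (x : ℕ) : ℝ :=
  ∑ m ∈ Finset.range (x + 1),
    if m ∈ A ∧ m + 2 ∈ A then
      (hawkinsY A m - (1 / ((m : ℝ) + 1)) * (1 - 1 / (m : ℝ)) * (hawkinsY A m) ^ 2)⁻¹
    else 0

/-- `G A` depends only on which integers below `m` belong to `A`. -/
def DependsBelow (m : ℕ) (G : Set ℕ → ℝ) : Prop :=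
  ∀ A B : Set ℕ, (∀ j < m, j ∈ A ↔ j ∈ B) → G A = G B

lemma DependsBelow.mono {m n : ℕ} {G : Set ℕ → ℝ} (hG : DependsBelow m G) (hmn : m ≤ n) :
    DependsBelow n G :=
  fun A B hAB => hG A B fun j hj => hAB j (hj.trans_le hmn)

lemma DependsBelow.comp₂ {m : ℕ} {G H : Set ℕ → ℝ} (hG : DependsBelow m G)
    (hH : DependsBelow m H) (f : ℝ → ℝ → ℝ) : DependsBelow m fun A => f (G A) (H A) :=
  fun A B hAB => by simp only [hG A B hAB, hH A B hAB]

lemma DependsBelow.comp {m : ℕ} {G : Set ℕ → ℝ} (hG : DependsBelow m G) (f : ℝ → ℝ) :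
    DependsBelow m fun A => f (G A) :=
  fun A B hAB => by simp only [hG A B hAB]

lemma dependsBelow_hawkinsY (m : ℕ) : DependsBelow m fun A => hawkinsY A m :=
  fun A B hAB => Finset.prod_congr rfl fun j hj => by
    simp only [hAB j (Finset.mem_range.mp hj)]

/-- The `0`-`1` indicator of `m ∈ A`. -/
noncomputable def memInd (m : ℕ) (A : Set ℕ) : ℝ := if m ∈ A then 1 else 0

lemma dependsBelow_memInd {m n : ℕ} (hmn : m < n) : DependsBelow n (memInd m) :=
  fun A B hAB => by simp only [memInd, hAB m hmn]

lemma DependsBelow.measurable {Ω : Type*} {m₀ : MeasurableSpace Ω} {α : Ω → Set ℕ} {m : ℕ}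
    (hα : ∀ j < m, MeasurableSet {ω | j ∈ α ω}) {G : Set ℕ → ℝ} (hG : DependsBelow m G) :
    Measurable fun ω => G (α ω) := by
  induction m generalizing G with
  | zero =>
    have : (fun ω => G (α ω)) = fun _ => G ∅ :=
      funext fun ω => hG _ _ fun j hj => absurd hj (Nat.not_lt_zero j)
    rw [this]
    exact measurable_const
  | succ m ih =>
    have key : ∀ s : Set ℕ → Set ℕ, (∀ A, ∀ B, (∀ j < m, j ∈ A ↔ j ∈ B) →
        ∀ j < m + 1, j ∈ s A ↔ j ∈ s B) → Measurable fun ω => G (s (α ω)) := fun s hs =>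
      ih (fun j hj => hα j (by omega)) (G := fun A => G (s A))
        fun A B hAB => hG _ _ (hs A B hAB)
    have h1 := key (fun A => insert m A) fun A B hAB j hj => by
      rcases Nat.lt_succ_iff_lt_or_eq.mp hj with h | h
      · simp [hAB j h]
      · simp [h]
    have h2 := key (fun A => A \ {m}) fun A B hAB j hj => by
      rcases Nat.lt_succ_iff_lt_or_eq.mp hj with h | h
      · simp [hAB j h]
      · simp [h]
    have : (fun ω => G (α ω)) =
        fun ω => if m ∈ α ω then G (insert m (α ω)) else G (α ω \ {m}) := by
      funext ω
      split_ifs with h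
      · rw [Set.insert_eq_of_mem h]
      · rw [Set.sdiff_singleton_eq_self h]
    rw [this]
    exact Measurable.ite (hα m (by omega)) h1 h2

lemma DependsBelow.exists_bound {m : ℕ} {G : Set ℕ → ℝ} (hG : DependsBelow m G) :
    ∃ C, ∀ A, ‖G A‖ ≤ C := by
  obtain ⟨C, hC⟩ := ((Finset.range m).powerset.image fun T : Finset ℕ => ‖G ↑T‖).bddAbove
  refine ⟨C, fun A => ?_⟩
  rw [hG A ↑((Finset.range m).filter (· ∈ A)) fun j hj => by simp [hj]]
  exact hC (Finset.mem_coe.mpr (Finset.mem_image_of_mem _ (by simp)))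

section Sieve

variable {Ω : Type*} [mΩ : MeasurableSpace Ω] {μ : Measure Ω} {α : Ω → Set ℕ}

lemma IsHawkinsSieve.integrable (h : IsHawkinsSieve μ α) {m : ℕ} {G : Set ℕ → ℝ}
    (hG : DependsBelow m G) : Integrable (fun ω => G (α ω)) μ := by
  have := h.isProb
  obtain ⟨C, hC⟩ := hG.exists_bound
  exact .of_bound (hG.measurable fun j _ => h.meas j).aestronglyMeasurable C
    (ae_of_all _ fun ω => hC _)

lemma sieveSigma_le (h : IsHawkinsSieve μ α) (m : ℕ) : sieveSigma α m ≤ mΩ := by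
  refine MeasurableSpace.generateFrom_le ?_
  rintro s ⟨j, -, -, rfl⟩
  exact h.meas j

lemma IsHawkinsSieve.measurableSet_sieveSigma (h : IsHawkinsSieve μ α) {m j : ℕ} (hj : j < m) :
    MeasurableSet[sieveSigma α m] {ω | j ∈ α ω} := by
  by_cases h2 : 2 ≤ j
  · exact MeasurableSpace.measurableSet_generateFrom ⟨j, h2, hj, rfl⟩
  · have : {ω | j ∈ α ω} = ∅ := Set.eq_empty_of_forall_notMem fun ω hω =>
      h2 (h.mem_ge_two ω j hω)
    rw [this]
    exact @MeasurableSet.empty _ (sieveSigma α m)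

/-- The defining property of the sieve, tested against functions of the past. -/
lemma IsHawkinsSieve.integral_mul_memInd (h : IsHawkinsSieve μ α) {m : ℕ} (hm : 2 ≤ m)
    {G : Set ℕ → ℝ} (hG : DependsBelow m G) :
    ∫ ω, G (α ω) * memInd m (α ω) ∂μ = ∫ ω, G (α ω) * hawkinsY (α ω) m ∂μ := by
  have := h.isProb
  have hI : Set.indicator {ω | m ∈ α ω} (fun _ => (1 : ℝ)) = fun ω => memInd m (α ω) := by
    funext ω
    simp [memInd, Set.indicator_apply]
  have hce := h.condExp_mem m hm
  rw [hI] at hce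
  have hdep : DependsBelow (m + 1) fun A => G A * memInd m A :=
    (hG.mono m.le_succ).comp₂ (dependsBelow_memInd m.lt_succ_self) (· * ·)
  have hmeas : StronglyMeasurable[sieveSigma α m] fun ω => G (α ω) :=
    Measurable.stronglyMeasurable (DependsBelow.measurable (m₀ := sieveSigma α m)
      (fun j hj => h.measurableSet_sieveSigma hj) hG)
  have hpull := condExp_mul_of_stronglyMeasurable_left (μ := μ) (m := sieveSigma α m)
    (f := fun ω => G (α ω)) (g := fun ω => memInd m (α ω))
    hmeas
    (h.integrable hdep) (h.integrable (dependsBelow_memInd m.lt_succ_self))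
  rw [← integral_condExp (sieveSigma_le h m)]
  refine integral_congr_ae (hpull.trans ?_)
  filter_upwards [hce] with ω hω
  simp only [Pi.mul_apply, hω]

end Sieve

lemma hawkinsY_succ (A : Set ℕ) (m : ℕ) :
    hawkinsY A (m + 1) = hawkinsY A m * (1 - memInd m A / m) := by
  unfold hawkinsY memInd
  rw [Finset.prod_range_succ]
  split_ifs <;> simp

lemma hawkinsY_two {A : Set ℕ} (hA : ∀ n ∈ A, 2 ≤ n) : hawkinsY A 2 = 1 := by
  have h0 : 0 ∉ A := fun h => absurd (hA 0 h) (by norm_num)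
  have h1 : 1 ∉ A := fun h => absurd (hA 1 h) (by norm_num)
  simp [hawkinsY, Finset.prod_range_succ, h0, h1]

lemma hawkinsY_pos {A : Set ℕ} (hA : ∀ n ∈ A, 2 ≤ n) (m : ℕ) : 0 < hawkinsY A m := by
  refine Finset.prod_pos fun j _ => ?_
  split_ifs with hj
  · have : (2 : ℝ) ≤ j := by exact_mod_cast hA j hj
    rw [sub_pos, div_lt_one (by linarith)]
    linarith
  · exact one_pos

lemma hawkinsY_le_one (A : Set ℕ) (m : ℕ) : hawkinsY A m ≤ 1 := by
  refine Finset.prod_le_one (fun j _ => ?_) fun j _ => ?_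
  · split_ifs
    · rcases j.eq_zero_or_pos with rfl | hj
      · simp
      · have : (1 : ℝ) ≤ j := by exact_mod_cast hj
        rw [sub_nonneg, div_le_one (by linarith)]
        exact this
    · exact zero_le_one
  · split_ifs
    · have : (0 : ℝ) ≤ 1 / j := by positivity
      linarith
    · exact le_rfl

lemma memInd_sq (m : ℕ) (A : Set ℕ) : memInd m A * memInd m A = memInd m A := by
  unfold memInd
  split_ifs <;> simp

lemma Mharm_succ (k : ℕ) : Mharm (k + 3) = Mharm (k + 2) + 1 / ((k : ℝ) + 1) := by
  unfold Mharm
  rw [show k + 3 - 2 = k + 1 by omega, show k + 2 - 2 = k by omega,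
    Finset.sum_Icc_succ_top (by omega)]
  push_cast
  ring

lemma Mharm_two : Mharm 2 = 1 := by simp [Mharm]

lemma one_le_Mharm (k : ℕ) : 1 ≤ Mharm k := by
  have : 0 ≤ ∑ j ∈ Finset.Icc 1 (k - 2), 1 / (j : ℝ) :=
    Finset.sum_nonneg fun j _ => by positivity
  unfold Mharm
  linarith

section Moments

variable {Ω : Type*} [mΩ : MeasurableSpace Ω] {μ : Measure Ω} {α : Ω → Set ℕ}

lemma inv_hawkinsY_succ (A : Set ℕ) (k : ℕ) :
    (hawkinsY A (k + 3))⁻¹ =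
      (hawkinsY A (k + 2))⁻¹ * (1 + memInd (k + 2) A / ((k : ℝ) + 1)) := by
  rw [hawkinsY_succ, mul_inv]
  congr 1
  have : (k : ℝ) + 1 ≠ 0 := by positivity
  have : (k : ℝ) + 2 ≠ 0 := by positivity
  unfold memInd
  split_ifs
  · rw [inv_eq_iff_eq_inv]
    push_cast
    rw [show (1 : ℝ) + 1 / (k + 1) = (k + 2) / (k + 1) by field_simp; ring, inv_div]
    field_simp
    ring
  · simp

lemma IsHawkinsSieve.integral_hawkinsY_succ (h : IsHawkinsSieve μ α) (k : ℕ) :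
    ∫ ω, hawkinsY (α ω) (k + 3) ∂μ =
      ∫ ω, hawkinsY (α ω) (k + 2) ∂μ - (∫ ω, hawkinsY (α ω) (k + 2) ^ 2 ∂μ) / ((k : ℝ) + 2) := by
  have hY := dependsBelow_hawkinsY (k + 2)
  have hstep := h.integral_mul_memInd (m := k + 2) (by omega) hY
  have h1 := h.integrable hY
  have h2 := h.integrable ((hY.mono (Nat.le_succ _)).comp₂
    (dependsBelow_memInd (Nat.lt_succ_self (k + 2))) fun x y => x * y)
  calc ∫ ω, hawkinsY (α ω) (k + 3) ∂μ
      = ∫ ω, (hawkinsY (α ω) (k + 2) -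
          (hawkinsY (α ω) (k + 2) * memInd (k + 2) (α ω)) / ((k : ℝ) + 2)) ∂μ := by
        refine integral_congr_ae (ae_of_all _ fun ω => ?_)
        simp only [hawkinsY_succ (α ω) (k + 2)]
        push_cast
        ring
    _ = _ := by
        rw [integral_sub h1 (h2.div_const _), integral_div, hstep]
        simp only [sq]

lemma IsHawkinsSieve.integral_inv_hawkinsY (h : IsHawkinsSieve μ α) (k : ℕ) :
    ∫ ω, (hawkinsY (α ω) (k + 2))⁻¹ ∂μ = Mharm (k + 2) := by
  have := h.isProb
  induction k with
  | zero =>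
    simp only [zero_add, hawkinsY_two (h.mem_ge_two _), Mharm_two]
    simp
  | succ k ih =>
    have hZ := (dependsBelow_hawkinsY (k + 2)).comp fun x => x⁻¹
    have hstep := h.integral_mul_memInd (m := k + 2) (by omega) hZ
    have h2 := h.integrable ((hZ.mono (Nat.le_succ _)).comp₂
      (dependsBelow_memInd (Nat.lt_succ_self (k + 2))) fun x y => x * y)
    rw [show k + 1 + 2 = k + 3 by omega, Mharm_succ, ← ih]
    calc ∫ ω, (hawkinsY (α ω) (k + 3))⁻¹ ∂μ
        = ∫ ω, ((hawkinsY (α ω) (k + 2))⁻¹ +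
            ((hawkinsY (α ω) (k + 2))⁻¹ * memInd (k + 2) (α ω)) / ((k : ℝ) + 1)) ∂μ := by
          refine integral_congr_ae (ae_of_all _ fun ω => ?_)
          simp only [inv_hawkinsY_succ]
          ring
      _ = _ := by
          rw [integral_add (h.integrable hZ) (h2.div_const _), integral_div, hstep]
          simp [inv_mul_cancel₀ (hawkinsY_pos (h.mem_ge_two _) _).ne']

lemma IsHawkinsSieve.integral_inv_hawkinsY_sq_succ (h : IsHawkinsSieve μ α) (k : ℕ) :
    ∫ ω, (hawkinsY (α ω) (k + 3))⁻¹ ^ 2 ∂μ =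
      ∫ ω, (hawkinsY (α ω) (k + 2))⁻¹ ^ 2 ∂μ +
        Mharm (k + 2) * (2 / ((k : ℝ) + 1) + 1 / ((k : ℝ) + 1) ^ 2) := by
  have hZ := (dependsBelow_hawkinsY (k + 2)).comp fun x => x⁻¹ ^ 2
  have hstep := h.integral_mul_memInd (m := k + 2) (by omega) hZ
  have h2 := h.integrable ((hZ.mono (Nat.le_succ _)).comp₂
    (dependsBelow_memInd (Nat.lt_succ_self (k + 2))) fun x y => x * y)
  have hYZ : ∀ ω, (hawkinsY (α ω) (k + 2))⁻¹ ^ 2 * hawkinsY (α ω) (k + 2) =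
      (hawkinsY (α ω) (k + 2))⁻¹ := fun ω => by
    have := (hawkinsY_pos (h.mem_ge_two ω) (k + 2)).ne'
    field_simp
  simp only [hYZ, h.integral_inv_hawkinsY] at hstep
  calc ∫ ω, (hawkinsY (α ω) (k + 3))⁻¹ ^ 2 ∂μ
      = ∫ ω, ((hawkinsY (α ω) (k + 2))⁻¹ ^ 2 +
          ((hawkinsY (α ω) (k + 2))⁻¹ ^ 2 * memInd (k + 2) (α ω)) *
            (2 / ((k : ℝ) + 1) + 1 / ((k : ℝ) + 1) ^ 2)) ∂μ := by
        refine integral_congr_ae (ae_of_all _ fun ω => ?_)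
        simp only [inv_hawkinsY_succ]
        generalize (k : ℝ) + 1 = r
        linear_combination (hawkinsY (α ω) (k + 2))⁻¹ ^ 2 / r ^ 2 *
          memInd_sq (k + 2) (α ω)
    _ = _ := by
        rw [integral_add (h.integrable hZ) (h2.mul_const _), integral_mul_const, hstep]

lemma IsHawkinsSieve.integral_lincomb (h : IsHawkinsSieve μ α) (k : ℕ) (c₀ c₁ c₂ c₃ c₄ : ℝ) :
    ∫ ω, (c₀ + c₁ * hawkinsY (α ω) (k + 2) + c₂ * hawkinsY (α ω) (k + 2) ^ 2 +
        c₃ * (hawkinsY (α ω) (k + 2))⁻¹ + c₄ * (hawkinsY (α ω) (k + 2))⁻¹ ^ 2) ∂μ =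
      c₀ + c₁ * ∫ ω, hawkinsY (α ω) (k + 2) ∂μ + c₂ * ∫ ω, hawkinsY (α ω) (k + 2) ^ 2 ∂μ +
        c₃ * Mharm (k + 2) + c₄ * ∫ ω, (hawkinsY (α ω) (k + 2))⁻¹ ^ 2 ∂μ := by
  have := h.isProb
  have hY := dependsBelow_hawkinsY (k + 2)
  have i1 := (h.integrable hY).const_mul c₁
  have i2 := (h.integrable (hY.comp fun x => x ^ 2)).const_mul c₂
  have i3 := (h.integrable (hY.comp fun x => x⁻¹)).const_mul c₃
  have i4 := (h.integrable (hY.comp fun x => x⁻¹ ^ 2)).const_mul c₄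
  have i0 : Integrable (fun _ : Ω => c₀) μ := integrable_const c₀
  have j1 : Integrable (fun ω => c₀ + c₁ * hawkinsY (α ω) (k + 2)) μ := i0.add i1
  have j2 : Integrable (fun ω => c₀ + c₁ * hawkinsY (α ω) (k + 2) +
    c₂ * hawkinsY (α ω) (k + 2) ^ 2) μ := j1.add i2
  have j3 : Integrable (fun ω => c₀ + c₁ * hawkinsY (α ω) (k + 2) +
    c₂ * hawkinsY (α ω) (k + 2) ^ 2 + c₃ * (hawkinsY (α ω) (k + 2))⁻¹) μ := j2.add i3
  rw [integral_add j3 i4, integral_add j2 i3, integral_add j1 i2, integral_add i0 i1]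
  simp only [integral_const_mul, h.integral_inv_hawkinsY, integral_const, probReal_univ, one_smul]

/-- Cauchy–Schwarz for `y⁻¹ - M` and `1 - M y`, as nonnegativity of a quadratic form. -/
lemma IsHawkinsSieve.quadratic_nonneg (h : IsHawkinsSieve μ α) (k : ℕ) (M t : ℝ)
    (hM : M = Mharm (k + 2)) :
    0 ≤ (∫ ω, (hawkinsY (α ω) (k + 2))⁻¹ ^ 2 ∂μ - M ^ 2) * t ^ 2
      - 2 * (M ^ 2 * ∫ ω, hawkinsY (α ω) (k + 2) ∂μ - M) * t
      + (1 - 2 * M * ∫ ω, hawkinsY (α ω) (k + 2) ∂μ +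
        M ^ 2 * ∫ ω, hawkinsY (α ω) (k + 2) ^ 2 ∂μ) := by
  have key : 0 ≤ ∫ ω, (((hawkinsY (α ω) (k + 2))⁻¹ - M) * t -
      (1 - M * hawkinsY (α ω) (k + 2))) ^ 2 ∂μ := integral_nonneg fun ω => sq_nonneg _
  have e := h.integral_lincomb k (M ^ 2 * t ^ 2 + 4 * M * t + 1) (-2 * M ^ 2 * t - 2 * M) (M ^ 2)
    (-2 * M * t ^ 2 - 2 * t) (t ^ 2)
  rw [← hM] at e
  calc (0 : ℝ) ≤ _ := key
    _ = _ := by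
      refine (integral_congr_ae (ae_of_all _ fun ω => ?_)).trans e
      have := (hawkinsY_pos (h.mem_ge_two ω) (k + 2)).ne'
      field_simp
      ring
    _ = _ := by ring

lemma IsHawkinsSieve.bias_nonneg (h : IsHawkinsSieve μ α) (k : ℕ) (M : ℝ)
    (hM : M = Mharm (k + 2)) : 0 ≤ M ^ 2 * ∫ ω, hawkinsY (α ω) (k + 2) ∂μ - M := by
  have key : 0 ≤ ∫ ω, hawkinsY (α ω) (k + 2) * ((hawkinsY (α ω) (k + 2))⁻¹ - M) ^ 2 ∂μ :=
    integral_nonneg fun ω => mul_nonneg (hawkinsY_pos (h.mem_ge_two ω) _).le (sq_nonneg _)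
  have e := h.integral_lincomb k (-2 * M) (M ^ 2) 0 1 0
  rw [← hM] at e
  calc (0 : ℝ) ≤ _ := key
    _ = _ := by
      refine (integral_congr_ae (ae_of_all _ fun ω => ?_)).trans e
      have := (hawkinsY_pos (h.mem_ge_two ω) (k + 2)).ne'
      field_simp
      ring
    _ = _ := by ring

lemma IsHawkinsSieve.bias_le_variance (h : IsHawkinsSieve μ α) (k : ℕ) (M : ℝ)
    (hM : M = Mharm (k + 2)) : M ^ 2 * ∫ ω, hawkinsY (α ω) (k + 2) ∂μ - M ≤
      ∫ ω, (hawkinsY (α ω) (k + 2))⁻¹ ^ 2 ∂μ - M ^ 2 := by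
  have key : 0 ≤ ∫ ω, (1 - hawkinsY (α ω) (k + 2)) * ((hawkinsY (α ω) (k + 2))⁻¹ - M) ^ 2 ∂μ :=
    integral_nonneg fun ω => mul_nonneg (sub_nonneg.mpr (hawkinsY_le_one _ _)) (sq_nonneg _)
  have e := h.integral_lincomb k (M ^ 2 + 2 * M) (-M ^ 2) 0 (-2 * M - 1) 1
  rw [← hM] at e
  refine sub_nonneg.mp ?_
  calc (0 : ℝ) ≤ _ := key
    _ = _ := by
      refine (integral_congr_ae (ae_of_all _ fun ω => ?_)).trans e
      have := (hawkinsY_pos (h.mem_ge_two ω) (k + 2)).ne'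
      field_simp
      ring
    _ = _ := by ring

lemma IsHawkinsSieve.variance_le (h : IsHawkinsSieve μ α) (k : ℕ) :
    ∫ ω, (hawkinsY (α ω) (k + 2))⁻¹ ^ 2 ∂μ - Mharm (k + 2) ^ 2 ≤
      2 - 2 * Mharm (k + 2) / ((k : ℝ) + 1) := by
  have := h.isProb
  induction k with
  | zero =>
    simp only [zero_add, hawkinsY_two (h.mem_ge_two _), Mharm_two]
    simp
  | succ k ih =>
    rw [show k + 1 + 2 = k + 3 by omega, h.integral_inv_hawkinsY_sq_succ, Mharm_succ]
    have h1 := one_le_Mharm (k + 2)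
    set M := Mharm (k + 2)
    set q := ∫ ω, (hawkinsY (α ω) (k + 2))⁻¹ ^ 2 ∂μ
    push_cast
    have hk : (0 : ℝ) < k + 1 := by positivity
    have hk1 : (1 : ℝ) ≤ k + 1 := by linarith [(Nat.cast_nonneg k : (0 : ℝ) ≤ k)]
    generalize (k : ℝ) + 1 = r at *
    have e : 2 - 2 * (M + 1 / r) / (r + 1) - (q + M * (2 / r + 1 / r ^ 2) - (M + 1 / r) ^ 2) =
        (2 - 2 * M / r - (q - M ^ 2)) + (M - 1) * (r - 1) / (r ^ 2 * (r + 1)) := by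
      field_simp
      ring
    have : 0 ≤ (M - 1) * (r - 1) / (r ^ 2 * (r + 1)) :=
      div_nonneg (mul_nonneg (by linarith) (by linarith)) (by positivity)
    linarith

end Moments

section TwinSum

variable {Ω : Type*} [mΩ : MeasurableSpace Ω] {μ : Measure Ω} {α : Ω → Set ℕ}

/-- The weight attached to the pair `m, m + 2` in `piHat`. -/
noncomputable def twinWeight (m : ℕ) (A : Set ℕ) : ℝ :=
  (hawkinsY A m - (1 / ((m : ℝ) + 1)) * (1 - 1 / (m : ℝ)) * (hawkinsY A m) ^ 2)⁻¹

lemma dependsBelow_twinWeight (m : ℕ) : DependsBelow m (twinWeight m) :=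
  (dependsBelow_hawkinsY m).comp
    fun y => (y - (1 / ((m : ℝ) + 1)) * (1 - 1 / (m : ℝ)) * y ^ 2)⁻¹

lemma twinWeight_mul {A : Set ℕ} (hA : ∀ n ∈ A, 2 ≤ n) {m : ℕ} (hm : 2 ≤ m) :
    twinWeight m A * (hawkinsY A m * (1 - hawkinsY A m * (1 - 1 / (m : ℝ)) / ((m : ℝ) + 1))) =
      1 := by
  have h0 := hawkinsY_pos hA m
  have h1 := hawkinsY_le_one A m
  have hm' : (2 : ℝ) ≤ m := by exact_mod_cast hm
  have e : hawkinsY A m * (1 - hawkinsY A m * (1 - 1 / (m : ℝ)) / ((m : ℝ) + 1)) =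
      hawkinsY A m - (1 / ((m : ℝ) + 1)) * (1 - 1 / (m : ℝ)) * (hawkinsY A m) ^ 2 := by ring
  rw [twinWeight, ← e]
  refine inv_mul_cancel₀ (mul_pos h0 ?_).ne'
  rw [sub_pos, div_lt_one (by linarith)]
  have : 0 < 1 / (m : ℝ) := by positivity
  nlinarith

lemma piHat_succ (A : Set ℕ) (n : ℕ) :
    piHat A (n + 1) = piHat A n +
      twinWeight (n + 1) A * memInd (n + 1) A * memInd (n + 1 + 2) A := by
  unfold piHat twinWeight memInd
  rw [Finset.sum_range_succ]
  congr 1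
  by_cases h1 : n + 1 ∈ A <;> by_cases h2 : n + 1 + 2 ∈ A <;> simp [h1, h2]

lemma dependsBelow_piHat (n : ℕ) : DependsBelow (n + 3) fun A => piHat A n := by
  intro A B hAB
  refine Finset.sum_congr rfl fun m hm => ?_
  have hm := Finset.mem_range.mp hm
  have hY : hawkinsY A m = hawkinsY B m :=
    dependsBelow_hawkinsY m A B fun j hj => hAB j (by omega)
  simp only [hAB m (by omega), hAB (m + 2) (by omega), hY]

lemma dependsBelow_twinWeight_mul_memInd {m : ℕ} :
    DependsBelow (m + 1) fun A => twinWeight m A * memInd m A :=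
  ((dependsBelow_twinWeight m).mono m.le_succ).comp₂ (dependsBelow_memInd m.lt_succ_self) (· * ·)

lemma IsHawkinsSieve.integral_twin (h : IsHawkinsSieve μ α) {m : ℕ} (hm : 2 ≤ m) :
    ∫ ω, twinWeight m (α ω) * memInd m (α ω) * memInd (m + 2) (α ω) ∂μ =
      (1 - 1 / (m : ℝ)) * ∫ ω, hawkinsY (α ω) m ∂μ := by
  have := h.isProb
  have hQ := dependsBelow_twinWeight_mul_memInd (m := m)
  have hY := (dependsBelow_hawkinsY m).mono m.le_succ
  have hQY : DependsBelow (m + 1) fun A => twinWeight m A * memInd m A * hawkinsY A m :=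
    hQ.comp₂ hY (· * ·)
  have hQYI : DependsBelow (m + 2)
      fun A => twinWeight m A * memInd m A * hawkinsY A m * memInd (m + 1) A :=
    (hQY.mono (Nat.le_succ _)).comp₂ (dependsBelow_memInd (Nat.lt_succ_self _)) (· * ·)
  have hQYY : DependsBelow (m + 1)
      fun A => twinWeight m A * memInd m A * hawkinsY A m * hawkinsY A (m + 1) :=
    hQY.comp₂ (dependsBelow_hawkinsY _) (· * ·)
  have hone : DependsBelow m fun _ => 1 := fun _ _ _ => rfl
  have e1 := h.integral_mul_memInd (m := m + 2) (by omega) (hQ.mono (Nat.le_succ _))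
  have e2 := h.integral_mul_memInd (m := m + 1) (by omega) hQY
  have e3 := h.integral_mul_memInd hm hone
  simp only [one_mul] at e3
  rw [e1, ← e3, ← integral_const_mul]
  calc ∫ ω, twinWeight m (α ω) * memInd m (α ω) * hawkinsY (α ω) (m + 2) ∂μ
      = ∫ ω, (1 - 1 / (m : ℝ)) * (twinWeight m (α ω) * memInd m (α ω) * hawkinsY (α ω) m -
          twinWeight m (α ω) * memInd m (α ω) * hawkinsY (α ω) m * memInd (m + 1) (α ω) /
            ((m : ℝ) + 1)) ∂μ := by
        refine integral_congr_ae (ae_of_all _ fun ω => ?_)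
        simp only [hawkinsY_succ (α ω) (m + 1), hawkinsY_succ (α ω) m]
        push_cast
        linear_combination (-(twinWeight m (α ω) * hawkinsY (α ω) m *
          (1 - memInd (m + 1) (α ω) / ((m : ℝ) + 1)) / m)) * memInd_sq m (α ω)
    _ = ∫ ω, (1 - 1 / (m : ℝ)) * (twinWeight m (α ω) * memInd m (α ω) * hawkinsY (α ω) m -
          twinWeight m (α ω) * memInd m (α ω) * hawkinsY (α ω) m * hawkinsY (α ω) (m + 1) /
            ((m : ℝ) + 1)) ∂μ := by
        rw [integral_const_mul, integral_const_mul,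
          integral_sub (h.integrable hQY) ((h.integrable hQYI).div_const _),
          integral_sub (h.integrable hQY) ((h.integrable hQYY).div_const _),
          integral_div, integral_div, e2]
    _ = _ := by
        refine integral_congr_ae (ae_of_all _ fun ω => ?_)
        have e := twinWeight_mul (h.mem_ge_two ω) hm
        simp only [hawkinsY_succ (α ω) m]
        linear_combination (1 - 1 / (m : ℝ)) * memInd m (α ω) * e +
          (1 - 1 / (m : ℝ)) * twinWeight m (α ω) * hawkinsY (α ω) m ^ 2 / ((m : ℝ) + 1) / m *
            memInd_sq m (α ω)

lemma IsHawkinsSieve.integral_piHat_succ (h : IsHawkinsSieve μ α) (k : ℕ) :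
    ∫ ω, piHat (α ω) (k + 3) ∂μ = ∫ ω, piHat (α ω) (k + 2) ∂μ +
      (1 - 1 / ((k : ℝ) + 3)) * ∫ ω, hawkinsY (α ω) (k + 3) ∂μ := by
  have hT : DependsBelow (k + 3 + 3)
      fun A => twinWeight (k + 3) A * memInd (k + 3) A * memInd (k + 3 + 2) A :=
    (dependsBelow_twinWeight_mul_memInd.mono (by omega)).comp₂
      (dependsBelow_memInd (by omega)) (· * ·)
  simp only [piHat_succ _ (k + 2)]
  rw [integral_add (h.integrable (dependsBelow_piHat (k + 2))) (h.integrable hT),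
    h.integral_twin (by omega)]
  push_cast
  rfl

end TwinSum

lemma Mharm_eq_harmonic (k : ℕ) : Mharm (k + 2) = 1 + (harmonic k : ℝ) := by
  rw [Mharm, harmonic_eq_sum_Icc]
  push_cast
  simp [one_div]

lemma tendsto_Mharm : Tendsto (fun k => Mharm (k + 2)) atTop atTop := by
  have h1 : Tendsto (fun k : ℕ => Real.log ((k + 1 : ℕ) : ℝ)) atTop atTop :=
    Real.tendsto_log_atTop.comp (tendsto_natCast_atTop_atTop.comp (tendsto_add_atTop_nat 1))
  refine tendsto_atTop_mono (fun k => ?_) h1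
  rw [Mharm_eq_harmonic]
  linarith [log_add_one_le_harmonic k]

lemma Mharm_cube_le (k : ℕ) : Mharm (k + 2) ^ 3 ≤ 6 * Real.exp 2 * ((k : ℝ) + 1) := by
  have hM := one_le_Mharm (k + 2)
  have h1 := Real.pow_div_factorial_le_exp (Mharm (k + 2)) (by linarith) 3
  have h2 : Real.exp (Mharm (k + 2)) ≤ Real.exp 2 * ((k : ℝ) + 1) := by
    rw [← Real.exp_log (show (0 : ℝ) < (k : ℝ) + 1 by positivity), ← Real.exp_add,
      Real.exp_le_exp, Mharm_eq_harmonic]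
    have h3 : Real.log k ≤ Real.log ((k : ℝ) + 1) := by
      rcases k.eq_zero_or_pos with rfl | hk
      · simp
      · exact Real.log_le_log (by exact_mod_cast hk) (by linarith)
    linarith [harmonic_le_one_add_log k]
  have h4 : ((Nat.factorial 3 : ℕ) : ℝ) = 6 := by norm_num [Nat.factorial]
  rw [h4] at h1
  linarith

lemma bias_step_le {r M a p b : ℝ} (hr : 1 ≤ r) (hM : 1 ≤ M) (ha1 : a ≤ 1)
    (hp : 0 ≤ p) (hb : b = M ^ 2 * a - M) (hb2 : b ≤ 2)
    (hW : b ^ 2 / 2 ≤ 1 - 2 * M * a + M ^ 2 * p) :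
    (M + 1 / r) ^ 2 * (a - p / (r + 1)) - (M + 1 / r) ≤
      b - b ^ 2 / (2 * (r + 1)) + 6 / r ^ 2 := by
  have hr0 : 0 < r := by linarith
  have hMa : M * a ≤ 3 := by
    have : M * (M * a) ≤ M * 3 := by nlinarith
    exact le_of_mul_le_mul_left this (by linarith)
  have e : b - b ^ 2 / (2 * (r + 1)) + 6 / r ^ 2 -
      ((M + 1 / r) ^ 2 * (a - p / (r + 1)) - (M + 1 / r)) =
      (1 - 2 * M * a + M ^ 2 * p - b ^ 2 / 2) / (r + 1) + 2 * (3 - M * a) / (r * (r + 1)) +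
        (1 - a) / r ^ 2 + 5 / (r ^ 2 * (r + 1)) +
        (2 * M / r + 1 / r ^ 2) * p / (r + 1) := by
    rw [hb]
    field_simp
    ring
  have h1 : 0 ≤ (1 - 2 * M * a + M ^ 2 * p - b ^ 2 / 2) / (r + 1) :=
    div_nonneg (by linarith) (by linarith)
  have h2 : 0 ≤ 2 * (3 - M * a) / (r * (r + 1)) := div_nonneg (by linarith) (by positivity)
  have h3 : 0 ≤ (1 - a) / r ^ 2 := div_nonneg (by linarith) (by positivity)
  have h4 : 0 ≤ 5 / (r ^ 2 * (r + 1)) := by positivity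
  have h5 : 0 ≤ (2 * M / r + 1 / r ^ 2) * p / (r + 1) := by positivity
  linarith

/-- The map `b ↦ b - b² / (2 (r + 1)) + 6 / r²` preserves the bound `b ≤ K / M`. -/
lemma bias_bound_step {r M b b' C K : ℝ} (hr : 3 ≤ r) (hM : 1 ≤ M) (hC : 0 ≤ C)
    (hMC : M ^ 3 ≤ C * r) (hK : K = 8 + 6 * C) (hb' : b' ≤ 2)
    (hbb : b' ≤ b - b ^ 2 / (2 * (r + 1)) + 6 / r ^ 2) (hb : b ≤ K / M) :
    b' ≤ K / (M + 1 / r) := by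
  have hr0 : 0 < r := by linarith
  have hM0 : 0 < M := by linarith
  rcases le_or_gt 2 (K / (M + 1 / r)) with h | h
  · linarith
  have hMr : 0 < M + 1 / r := by positivity
  have h1r : 1 / r ≤ 1 := by rw [div_le_one hr0]; linarith
  have ht : K / M ≤ 4 := by
    rw [div_lt_iff₀ hMr] at h
    rw [div_le_iff₀ hM0]
    nlinarith
  set t := K / M with htdef
  have hKt : K = t * M := by rw [htdef]; field_simp
  have hmono : b - b ^ 2 / (2 * (r + 1)) ≤ t - t ^ 2 / (2 * (r + 1)) := by
    have e : t - t ^ 2 / (2 * (r + 1)) - (b - b ^ 2 / (2 * (r + 1))) =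
        (t - b) * (2 * (r + 1) - t - b) / (2 * (r + 1)) := by
      field_simp
      ring
    have : 0 ≤ (t - b) * (2 * (r + 1) - t - b) / (2 * (r + 1)) :=
      div_nonneg (mul_nonneg (by linarith) (by linarith)) (by linarith)
    linarith
  have hsq : M ^ 2 ≤ C * r := by nlinarith [mul_nonneg (sq_nonneg M) (by linarith : 0 ≤ M - 1)]
  have hKK : 6 * C + K ≤ K ^ 2 / 4 := by rw [hK]; nlinarith
  have h6 : 6 / r ^ 2 ≤ 6 * C / (r * M ^ 2) := by
    rw [div_le_div_iff₀ (by positivity) (by positivity)]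
    nlinarith
  have h7 : K / M - K / (M + 1 / r) ≤ K / (r * M ^ 2) := by
    have hK0 : 0 ≤ K := by linarith
    have e : K / M - K / (M + 1 / r) = K / (r * (M * (M + 1 / r))) := by
      field_simp
      ring
    rw [e]
    refine div_le_div_of_nonneg_left hK0 (by positivity) ?_
    have : 0 < 1 / r := by positivity
    nlinarith [mul_pos hr0 hM0, mul_pos (mul_pos hr0 hM0) this]
  have h8 : K ^ 2 / 4 / (r * M ^ 2) ≤ t ^ 2 / (2 * (r + 1)) := by
    have e : K ^ 2 / 4 / (r * M ^ 2) = t ^ 2 / (4 * r) := by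
      rw [hKt]
      field_simp
    rw [e]
    exact div_le_div_of_nonneg_left (sq_nonneg t) (by linarith) (by linarith)
  have h9 : 6 * C / (r * M ^ 2) + K / (r * M ^ 2) ≤ K ^ 2 / 4 / (r * M ^ 2) := by
    rw [← add_div]
    exact div_le_div_of_nonneg_right hKK (by positivity)
  linarith

lemma IsHawkinsSieve.bias_le {Ω : Type*} [MeasurableSpace Ω] {μ : Measure Ω} {α : Ω → Set ℕ}
    (h : IsHawkinsSieve μ α) : ∃ K : ℝ, 0 ≤ K ∧ ∀ k : ℕ,
      Mharm (k + 2) ^ 2 * ∫ ω, hawkinsY (α ω) (k + 2) ∂μ - Mharm (k + 2) ≤ K / Mharm (k + 2) := by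
  have := h.isProb
  have hC : 0 ≤ 6 * Real.exp 2 := by positivity
  refine ⟨8 + 6 * (6 * Real.exp 2), by positivity, ?_⟩
  have hle2 : ∀ k : ℕ,
      Mharm (k + 2) ^ 2 * ∫ ω, hawkinsY (α ω) (k + 2) ∂μ - Mharm (k + 2) ≤ 2 := fun k => by
    have h1 := h.bias_le_variance k _ rfl
    have h2 := h.variance_le k
    have h3 := one_le_Mharm (k + 2)
    have : 0 ≤ 2 * Mharm (k + 2) / ((k : ℝ) + 1) := by positivity
    linarith
  have hsmall : ∀ k : ℕ, k ≤ 2 → Mharm (k + 2) ≤ 4 := by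
    intro k hk
    interval_cases k <;> simp [Mharm, Finset.sum_Icc_succ_top] <;> norm_num
  have hbase : ∀ k : ℕ, k ≤ 2 →
      Mharm (k + 2) ^ 2 * ∫ ω, hawkinsY (α ω) (k + 2) ∂μ - Mharm (k + 2) ≤
        (8 + 6 * (6 * Real.exp 2)) / Mharm (k + 2) := fun k hk => by
    have h3 := one_le_Mharm (k + 2)
    refine (hle2 k).trans ?_
    rw [le_div_iff₀ (by linarith)]
    linarith [hsmall k hk]
  intro k
  induction k with
  | zero => exact hbase 0 (by norm_num)
  | succ k ih =>
    rcases Nat.lt_or_ge k 2 with hk | hk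
    · exact hbase (k + 1) (by omega)
    have hk' : (2 : ℝ) ≤ k := by exact_mod_cast hk
    have hstep := h.integral_hawkinsY_succ k
    have hb' := hle2 (k + 1)
    rw [show k + 1 + 2 = k + 3 by omega, Mharm_succ] at hb' ⊢
    have hM := one_le_Mharm (k + 2)
    have hY := dependsBelow_hawkinsY (k + 2)
    have ha1 : ∫ ω, hawkinsY (α ω) (k + 2) ∂μ ≤ 1 := by
      have := integral_mono (h.integrable hY) (integrable_const (1 : ℝ))
        fun ω => hawkinsY_le_one (α ω) (k + 2)
      simpa using this
    have hp : 0 ≤ ∫ ω, hawkinsY (α ω) (k + 2) ^ 2 ∂μ := integral_nonneg fun ω => sq_nonneg _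
    have hV : ∫ ω, (hawkinsY (α ω) (k + 2))⁻¹ ^ 2 ∂μ - Mharm (k + 2) ^ 2 ≤ 2 := by
      have h2 := h.variance_le k
      have : 0 ≤ 2 * Mharm (k + 2) / ((k : ℝ) + 1) := by positivity
      linarith
    have hquad := h.quadratic_nonneg k (Mharm (k + 2))
      ((Mharm (k + 2) ^ 2 * ∫ ω, hawkinsY (α ω) (k + 2) ∂μ - Mharm (k + 2)) / 2) rfl
    refine bias_bound_step (r := (k : ℝ) + 1) (by linarith) hM hC (Mharm_cube_le k) rfl hb' ?_ ih
    rw [hstep, show (k : ℝ) + 2 = k + 1 + 1 by ring]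
    refine bias_step_le (by linarith) hM ha1 hp rfl (hle2 k) ?_
    nlinarith [mul_nonneg (sub_nonneg.mpr hV) (sq_nonneg
      ((Mharm (k + 2) ^ 2 * ∫ ω, hawkinsY (α ω) (k + 2) ∂μ - Mharm (k + 2)) / 2))]

lemma isBigO_of_increments {u v : ℕ → ℝ} {C : ℝ} (hC : 0 < C) (hv : ∀ n, 0 < v n)
    (huv : ∀ᶠ n in atTop, |u (n + 1) - u n| ≤ C * (v (n + 1) - v n)) :
    u =O[atTop] v := by
  obtain ⟨N, hN⟩ := eventually_atTop.mp huv
  have key : ∀ n ≥ N, |u n| - |u N| ≤ C * (v n - v N) := fun n hn => by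
    induction n, hn using Nat.le_induction with
    | base => simp
    | succ n hn ih =>
      have h1 := hN n hn
      have h2 : |u (n + 1)| ≤ |u (n + 1) - u n| + |u n| := by
        simpa using abs_add_le (u (n + 1) - u n) (u n)
      linarith
  refine IsBigO.of_bound (|u N| / v N + C) ?_
  filter_upwards [eventually_ge_atTop N] with n hn
  have hn' := key n hn
  have hmono : v N ≤ v n :=
    monotoneOn_nat_Ici_of_le_succ (fun k hk =>
      sub_nonneg.mp (nonneg_of_mul_nonneg_right ((abs_nonneg _).trans (hN k hk)) hC)) (Set.mem_Ici.mpr le_rfl) hn hn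
  have h1 : |u N| ≤ |u N| / v N * v n := by
    rw [div_mul_eq_mul_div, le_div_iff₀ (hv N)]
    exact mul_le_mul_of_nonneg_left hmono (abs_nonneg _)
  rw [Real.norm_eq_abs, Real.norm_eq_abs, abs_of_pos (hv n), add_mul]
  linarith [mul_pos hC (hv N)]

lemma main_increment_bound {r M a C K : ℝ} (hr : 1 ≤ r) (hM : 48 ≤ M) (hC : 0 ≤ C)
    (hK : 0 ≤ K) (hMC : M ^ 3 ≤ C * r) (ha1 : a ≤ 1)
    (hlow : 0 ≤ (M + 1 / r) ^ 2 * a - (M + 1 / r))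
    (hup : (M + 1 / r) ^ 2 * a - (M + 1 / r) ≤ K / (M + 1 / r)) :
    |(1 - 1 / (r + 2)) * a - (((r + 2) / (M + 1 / r) + (r + 2) / (M + 1 / r) ^ 2) -
        ((r + 1) / M + (r + 1) / M ^ 2))| ≤
      2 * (K + 24 * C + 16) * ((r + 2) / (M + 1 / r) ^ 3 - (r + 1) / M ^ 3) := by
  have hr0 : 0 < r := by linarith
  have hM0 : 0 < M := by linarith
  have hδ : 0 < 1 / r := by positivity
  have h1r : 1 / r ≤ 1 := by rw [div_le_one hr0]; linarith
  obtain ⟨N, hN⟩ : ∃ N, N = M + 1 / r := ⟨_, rfl⟩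
  have hN0 : 0 < N := by linarith
  have hMN : M ≤ N := by linarith
  have hN2 : N ≤ 2 * M := by linarith
  rw [← hN] at hlow hup ⊢
  have hrN : 1 / r = N - M := by linarith
  have hN3 : 1 / r ≤ 8 * C / N ^ 3 := by
    rw [div_le_div_iff₀ hr0 (by positivity)]
    have : N ^ 3 ≤ (2 * M) ^ 3 := by gcongr
    nlinarith
  have hv : 1 / N ^ 3 ≤ 2 * ((r + 2) / N ^ 3 - (r + 1) / M ^ 3) := by
    have e : (r + 1) / N ^ 3 = (r + 1) / M ^ 3 -
        (1 + 1 / r) * (M ^ 2 + M * N + N ^ 2) / (M ^ 3 * N ^ 3) := by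
      have : (r + 1) * (N - M) = 1 + 1 / r := by rw [← hrN]; field_simp
      rw [← this]
      field_simp
      ring
    have h1 : (1 + 1 / r) * (M ^ 2 + M * N + N ^ 2) / (M ^ 3 * N ^ 3) ≤ 1 / 2 / N ^ 3 := by
      rw [div_le_div_iff₀ (by positivity) (by positivity)]
      have h2 : (1 + 1 / r) * (M ^ 2 + M * N + N ^ 2) ≤ 2 * (12 * M ^ 2) := by
        gcongr
        · linarith
        · nlinarith
      have h3 : 2 * (12 * M ^ 2) ≤ 1 / 2 * M ^ 3 := by nlinarith [sq_nonneg M]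
      calc _ ≤ (1 / 2 * M ^ 3) * N ^ 3 :=
          mul_le_mul_of_nonneg_right (h2.trans h3) (by positivity)
        _ = _ := by ring
    have e2 : (r + 2) / N ^ 3 = (r + 1) / N ^ 3 + 1 / N ^ 3 := by ring
    have e3 : 1 / 2 / N ^ 3 = (1 / N ^ 3) / 2 := by ring
    linarith
  have ha : |a - 1 / N| ≤ K / N ^ 3 := by
    have e : a - 1 / N = (N ^ 2 * a - N) / N ^ 2 := by field_simp
    rw [e, abs_of_nonneg (div_nonneg hlow (by positivity))]
    calc (N ^ 2 * a - N) / N ^ 2 ≤ K / N / N ^ 2 := by gcongr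
      _ = _ := by field_simp
  have ha0 : 0 ≤ a := by
    by_contra! hneg
    nlinarith [mul_pos hN0 hN0]
  have h1 : |1 / (r + 2) * a| ≤ 8 * C / N ^ 3 := by
    rw [abs_of_nonneg (by positivity)]
    refine le_trans ?_ hN3
    calc 1 / (r + 2) * a ≤ 1 / r * 1 := by gcongr; linarith
      _ = _ := mul_one _
  have e : (1 - 1 / (r + 2)) * a - ((r + 2) / N + (r + 2) / N ^ 2 -
      ((r + 1) / M + (r + 1) / M ^ 2)) = (a - 1 / N) - 1 / (r + 2) * a +
        (1 / r) * (1 + N) / (M * N ^ 2) + (1 + 1 / r) * (M + N) / (M ^ 2 * N ^ 2) := by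
    have h2 : (r + 1) * (N - M) = 1 + 1 / r := by rw [← hrN]; field_simp
    have h3 : (1 / r) * (1 + N) = N * (1 + 1 / r) - M := by linarith
    rw [h3, ← h2]
    field_simp
    ring
  have h2 : |(1 / r) * (1 + N) / (M * N ^ 2)| ≤ 8 * C / N ^ 3 := by
    rw [abs_of_nonneg (by positivity)]
    refine le_trans ?_ hN3
    rw [mul_div_assoc]
    refine mul_le_of_le_one_right hδ.le ?_
    rw [div_le_one (by positivity)]
    nlinarith [mul_pos hN0 hM0, sq_nonneg N]
  have h3 : |(1 + 1 / r) * (M + N) / (M ^ 2 * N ^ 2)| ≤ 16 / N ^ 3 := by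
    rw [abs_of_nonneg (by positivity), div_le_div_iff₀ (by positivity) (by positivity)]
    have h4 : (1 + 1 / r) * (M + N) * N ≤ 16 * M ^ 2 := by
      calc (1 + 1 / r) * (M + N) * N ≤ 2 * (M + 2 * M) * (2 * M) := by gcongr; linarith
        _ ≤ _ := by nlinarith
    calc _ = ((1 + 1 / r) * (M + N) * N) * N ^ 2 := by ring
      _ ≤ (16 * M ^ 2) * N ^ 2 := by gcongr
      _ = _ := by ring
  rw [e]
  calc _ ≤ |a - 1 / N| + |1 / (r + 2) * a| + |(1 / r) * (1 + N) / (M * N ^ 2)| +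
        |(1 + 1 / r) * (M + N) / (M ^ 2 * N ^ 2)| := by
        refine (abs_add_le _ _).trans (add_le_add_left ((abs_add_le _ _).trans
          (add_le_add_left (abs_sub _ _) _)) _)
    _ ≤ K / N ^ 3 + 8 * C / N ^ 3 + 8 * C / N ^ 3 + 16 / N ^ 3 := by gcongr
    _ ≤ (K + 24 * C + 16) * (1 / N ^ 3) := by
        have : 0 ≤ C / N ^ 3 := by positivity
        have e : (K + 24 * C + 16) * (1 / N ^ 3) =
          K / N ^ 3 + 24 * (C / N ^ 3) + 16 / N ^ 3 := by ring
        rw [e, mul_div_assoc]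
        linarith
    _ ≤ (K + 24 * C + 16) * (2 * ((r + 2) / N ^ 3 - (r + 1) / M ^ 3)) := by gcongr
    _ = _ := by ring

theorem piHat_expectation_asymptotic {Ω : Type*} [MeasurableSpace Ω] (μ : Measure Ω)
    (α : Ω → Set ℕ) (h : IsHawkinsSieve μ α) :
    (fun n : ℕ => (∫ ω, piHat (α ω) n ∂μ) - ((n : ℝ) / Mharm n + (n : ℝ) / (Mharm n) ^ 2))
      =O[atTop] fun n : ℕ => (n : ℝ) / (Mharm n) ^ 3 := by
  obtain ⟨K, hK, hbias⟩ := h.bias_le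
  have := h.isProb
  have key : (fun k : ℕ => (∫ ω, piHat (α ω) (k + 2) ∂μ) - (((k + 2 : ℕ) : ℝ) / Mharm (k + 2) +
      ((k + 2 : ℕ) : ℝ) / (Mharm (k + 2)) ^ 2)) =O[atTop]
        fun k : ℕ => ((k + 2 : ℕ) : ℝ) / (Mharm (k + 2)) ^ 3 := by
    refine isBigO_of_increments (C := 2 * (K + 24 * (6 * Real.exp 2) + 16))
      (by positivity) (fun k => ?_) ?_
    · have := one_le_Mharm (k + 2)
      positivity
    · filter_upwards [tendsto_Mharm.eventually_ge_atTop 48] with k hk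
      have hlow := h.bias_nonneg (k + 1) _ rfl
      have hup := hbias (k + 1)
      have ha1 : ∫ ω, hawkinsY (α ω) (k + 3) ∂μ ≤ 1 := by
        have := integral_mono (h.integrable (dependsBelow_hawkinsY (k + 3)))
          (integrable_const (1 : ℝ)) fun ω => hawkinsY_le_one (α ω) (k + 3)
        simpa using this
      rw [show k + 1 + 2 = k + 3 by omega, Mharm_succ] at hlow hup
      rw [show k + 1 + 2 = k + 3 by omega, Mharm_succ, h.integral_piHat_succ]
      have hr : (1 : ℝ) ≤ (k : ℝ) + 1 := by linarith [(Nat.cast_nonneg k : (0 : ℝ) ≤ k)]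
      have hinc := main_increment_bound hr hk (by positivity) hK (Mharm_cube_le k) ha1 hlow hup
      rw [show (k : ℝ) + 1 + 2 = k + 3 by ring, show (k : ℝ) + 1 + 1 = k + 2 by ring] at hinc
      push_cast
      convert hinc using 2
      ring
  obtain ⟨c, hc⟩ := key.bound
  refine IsBigO.of_bound c ?_
  obtain ⟨N, hN⟩ := eventually_atTop.mp hc
  filter_upwards [eventually_ge_atTop (N + 2)] with n hn
  obtain ⟨k, rfl⟩ : ∃ k, n = k + 2 := ⟨n - 2, by omega⟩
  exact hN k (by omega)
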